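/- Let P_1 > 0 and N_3 > 0. Then the supremum, over rho_1 in [0,1) and alpha_{13} > 0, of (1/2) log_2( (1-rho_1) P_1 / ((1-alpha_{13})^2 (1-rho_1) P_1 + alpha_{13}^2 N_3) ) equals (1/2) log_2(1 + P_1/N_3). Equivalently, the maximum sum-rate R1 + R2 over the achievable region of Proposition 3 equals C(P_1/N_3). -/

import Mathlib

noncomputable section

namespace Stmt4

/-- `C(x) = (1/2) log₂ (1+x)`; note `C(-1+x) = (1/2) log₂ x`. -/
def Cfun (x : ℝ) : ℝ := (1 / 2) * Real.logb 2 (1 + x)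

/-- The effective signal-to-noise ratio at inflation factor `α` is at most `1 + q / N`. -/
lemma div_inflation_le {q N : ℝ} (α : ℝ) (hq : 0 < q) (hN : 0 < N) :
    q / ((1 - α) ^ 2 * q + α ^ 2 * N) ≤ 1 + q / N := by
  have hD : 0 ≤ (1 - α) ^ 2 * q + α ^ 2 * N := by positivity
  refine div_le_of_le_mul₀ hD (by positivity) ?_
  have h : (1 + q / N) * ((1 - α) ^ 2 * q + α ^ 2 * N) =
      q + ((1 - α) * q - α * N) ^ 2 / N := by
    field_simp
    ring
  rw [h]
  exact le_add_of_nonneg_right (by positivity)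

/-- The inflation factor `q / (q + N)` attains the signal-to-noise ratio `1 + q / N`. -/
lemma div_inflation_eq {q N : ℝ} (hq : 0 < q) (hN : 0 < N) :
    q / ((1 - q / (q + N)) ^ 2 * q + (q / (q + N)) ^ 2 * N) = 1 + q / N := by
  have h : (1 - q / (q + N)) ^ 2 * q + (q / (q + N)) ^ 2 * N = q * N / (q + N) := by
    field_simp
    ring
  rw [h]
  field_simp
  ring

/-- **Maximum sum-rate of Proposition 3.** For `P₁ > 0` and `N₃ > 0`, the supremum over
`ρ₁ ∈ [0,1)` and `α₁₃ > 0` of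
`(1/2) log₂ ( (1-ρ₁) P₁ / ((1-α₁₃)² (1-ρ₁) P₁ + α₁₃² N₃) )` equals
`(1/2) log₂ (1 + P₁/N₃) = C(P₁/N₃)`. -/
theorem maxSumRate (P1 N3 : ℝ) (hP1 : 0 < P1) (hN3 : 0 < N3) :
    sSup {r : ℝ | ∃ ρ1 ∈ Set.Ico (0 : ℝ) 1, ∃ α13 : ℝ, 0 < α13 ∧
        r = (1 / 2) * Real.logb 2 ((1 - ρ1) * P1 /
          ((1 - α13) ^ 2 * (1 - ρ1) * P1 + α13 ^ 2 * N3))} =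
      Cfun (P1 / N3) := by
  apply IsGreatest.csSup_eq
  constructor
  · refine ⟨0, by simp, P1 / (P1 + N3), by positivity, ?_⟩
    rw [Cfun, sub_zero, mul_one, one_mul, div_inflation_eq hP1 hN3]
  · rintro r ⟨ρ, ⟨hρ0, hρ1⟩, α, hα, rfl⟩
    have hρ : 0 < 1 - ρ := sub_pos.mpr hρ1
    have hq : 0 < (1 - ρ) * P1 := mul_pos hρ hP1
    have hqP : (1 - ρ) * P1 ≤ P1 := mul_le_of_le_one_left hP1.le (by linarith)
    rw [Cfun, mul_assoc ((1 - α) ^ 2)]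
    refine mul_le_mul_of_nonneg_left ?_ (by norm_num)
    refine Real.logb_le_logb_of_le (by norm_num) (by positivity) ?_
    exact (div_inflation_le α hq hN3).trans (by gcongr)

end Stmt4
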